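/- arXiv:1712.06947 — 4 statements merged into one kernel-verified Lean document; each statement's English description precedes it below -/
import Mathlib

section
/- For every swap-attempt frequency ν > 0, the joint density ϱ(X,σ) is stationary for the parallel-tempering stochastic switching process, in the sense that the stationary forward Kolmogorov (Fokker–Planck) equation holds pointwise: for every X ∈ (ℝ^d)^N and every σ ∈ S_N, Σ_{k=1}^N [ div_{x_k}( β⁻¹ β_{σ(k)} ∇V(x_k) ϱ(X,σ) ) + β⁻¹ Δ_{x_k} ϱ(X,σ) ] − ν Σ_{σ'≠σ} h_{σσ'}(X) ϱ(X,σ) + ν Σ_{σ'≠σ} h_{σ'σ}(X) ϱ(X,σ') = 0. -/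
open Real Equiv Finset MeasureTheory

/-- Gradient of a function on `ℝ^d` (as `Fin d → ℝ`), componentwise via `fderiv`. -/
noncomputable def grad (d : ℕ) (V : (Fin d → ℝ) → ℝ) (x : Fin d → ℝ) : Fin d → ℝ :=
  fun i => fderiv ℝ V x (Pi.single i 1)

/-- Partial derivative in the `i`-th coordinate of the `k`-th replica of a function on
configuration space `(ℝ^d)^N`. -/
noncomputable def pDeriv (d N : ℕ) (k : Fin N) (i : Fin d)
    (f : (Fin N → Fin d → ℝ) → ℝ) (X : Fin N → Fin d → ℝ) : ℝ :=
  fderiv ℝ f X (Pi.single k (Pi.single i 1))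

/-- Divergence with respect to the variables of the `k`-th replica of a vector field
`F : (ℝ^d)^N → ℝ^d`. -/
noncomputable def pDiv (d N : ℕ) (k : Fin N)
    (F : (Fin N → Fin d → ℝ) → Fin d → ℝ) (X : Fin N → Fin d → ℝ) : ℝ :=
  ∑ i : Fin d, pDeriv d N k i (fun Y => F Y i) X

/-- Laplacian with respect to the variables of the `k`-th replica. -/
noncomputable def pLap (d N : ℕ) (k : Fin N)
    (f : (Fin N → Fin d → ℝ) → ℝ) (X : Fin N → Fin d → ℝ) : ℝ :=
  ∑ i : Fin d, pDeriv d N k i (fun Y => pDeriv d N k i f Y) X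

/-- The permuted potential `𝒱(X,σ) = β⁻¹ ∑ᵢ β_{σ(i)} V(xᵢ)`, with reference
inverse temperature `β = β 0`. -/
noncomputable def permPotential (d N : ℕ) [NeZero N] (V : (Fin d → ℝ) → ℝ) (β : Fin N → ℝ)
    (X : Fin N → Fin d → ℝ) (σ : Equiv.Perm (Fin N)) : ℝ :=
  (β 0)⁻¹ * ∑ i : Fin N, β (σ i) * V (X i)

/-- The conditional permutation weights `ϱ(σ∣X)`. -/
noncomputable def condWeight (d N : ℕ) [NeZero N] (V : (Fin d → ℝ) → ℝ) (β : Fin N → ℝ)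
    (σ : Equiv.Perm (Fin N)) (X : Fin N → Fin d → ℝ) : ℝ :=
  Real.exp (-(β 0) * permPotential d N V β X σ) /
    ∑ σ' : Equiv.Perm (Fin N), Real.exp (-(β 0) * permPotential d N V β X σ')

/-- Partition function `Z_{β_i} = ∫ e^{−β_i V}`. -/
noncomputable def partZ (d N : ℕ) (V : (Fin d → ℝ) → ℝ) (β : Fin N → ℝ) (i : Fin N) : ℝ :=
  ∫ x : Fin d → ℝ, Real.exp (-(β i) * V x)

/-- Single-replica Boltzmann density `ρ_{β_i}(x) = Z_{β_i}⁻¹ e^{−β_i V(x)}`. -/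
noncomputable def boltz (d N : ℕ) (V : (Fin d → ℝ) → ℝ) (β : Fin N → ℝ)
    (i : Fin N) (x : Fin d → ℝ) : ℝ :=
  (partZ d N V β i)⁻¹ * Real.exp (-(β i) * V x)

/-- The joint density `ϱ(X,σ) = (N!)⁻¹ ∏ᵢ ρ_{β_{σ(i)}}(xᵢ)`. -/
noncomputable def jointDensity (d N : ℕ) (V : (Fin d → ℝ) → ℝ) (β : Fin N → ℝ)
    (X : Fin N → Fin d → ℝ) (σ : Equiv.Perm (Fin N)) : ℝ :=
  ((N.factorial : ℝ))⁻¹ * ∏ i : Fin N, boltz d N V β (σ i) (X i)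

theorem jointDensity_eq_exp (d N : ℕ) (V : (Fin d → ℝ) → ℝ) (β : Fin N → ℝ)
    (X : Fin N → Fin d → ℝ) (σ : Equiv.Perm (Fin N)) :
    jointDensity d N V β X σ = ((N.factorial : ℝ))⁻¹ * (∏ i, partZ d N V β i)⁻¹ *
      Real.exp (-∑ i, β (σ i) * V (X i)) := by
  have hZ : ∏ i, (partZ d N V β (σ i))⁻¹ = (∏ i, partZ d N V β i)⁻¹ := by
    rw [Equiv.prod_comp σ (fun i => (partZ d N V β i)⁻¹), Finset.prod_inv_distrib]
  simp only [jointDensity, boltz, Finset.prod_mul_distrib, hZ, ← Real.exp_sum, mul_assoc,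
    neg_mul, Finset.sum_neg_distrib]

theorem pDeriv_const_mul (d N : ℕ) (k : Fin N) (i : Fin d) (c : ℝ)
    (f : (Fin N → Fin d → ℝ) → ℝ) (X : Fin N → Fin d → ℝ) :
    pDeriv d N k i (fun Y => c * f Y) X = c * pDeriv d N k i f X := by
  have h : fderiv ℝ (fun Y => c * f Y) X = c • fderiv ℝ f X :=
    congrFun (fderiv_const_smul_field (f := f) c) X
  simp [pDeriv, h]

theorem pDeriv_jointDensity (d N : ℕ) (V : (Fin d → ℝ) → ℝ) (hV : Differentiable ℝ V)
    (β : Fin N → ℝ) (k : Fin N) (i : Fin d) (X : Fin N → Fin d → ℝ)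
    (σ : Equiv.Perm (Fin N)) :
    pDeriv d N k i (fun Y => jointDensity d N V β Y σ) X =
      -β (σ k) * (grad d V (X k) i * jointDensity d N V β X σ) := by
  have hterm (j : Fin N) : HasFDerivAt (fun Y : Fin N → Fin d → ℝ => β (σ j) * V (Y j))
      (β (σ j) • (fderiv ℝ V (X j)).comp (ContinuousLinearMap.proj j)) X :=
    ((hV (X j)).hasFDerivAt.comp X
      (ContinuousLinearMap.proj (R := ℝ) (φ := fun _ : Fin N => Fin d → ℝ) j).hasFDerivAt
      ).const_mul _
  have hexp := (HasFDerivAt.fun_sum (u := Finset.univ) fun j _ => hterm j).fun_neg.exp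
  have hsum : ∑ j : Fin N, β (σ j) * fderiv ℝ V (X j)
      ((Pi.single k (Pi.single i 1) : Fin N → Fin d → ℝ) j) =
      β (σ k) * fderiv ℝ V (X k) (Pi.single i 1) := by
    rw [Finset.sum_eq_single k]
    · simp
    · intro j _ hj
      simp [Pi.single_eq_of_ne hj]
    · simp
  simp only [jointDensity_eq_exp]
  rw [pDeriv_const_mul, pDeriv, hexp.fderiv]
  simp only [ContinuousLinearMap.smul_apply, ContinuousLinearMap.neg_apply,
    ContinuousLinearMap.sum_apply, ContinuousLinearMap.comp_apply,
    ContinuousLinearMap.proj_apply, smul_eq_mul, hsum, grad]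
  ring

/-- The drift and diffusion fluxes of a single replica cancel. -/
theorem pDiv_add_pLap_jointDensity (d N : ℕ) [NeZero N] (V : (Fin d → ℝ) → ℝ)
    (hV : Differentiable ℝ V) (β : Fin N → ℝ) (k : Fin N) (X : Fin N → Fin d → ℝ)
    (σ : Equiv.Perm (Fin N)) :
    pDiv d N k
        (fun Y i => (β 0)⁻¹ * β (σ k) * grad d V (Y k) i * jointDensity d N V β Y σ) X
      + (β 0)⁻¹ * pLap d N k (fun Y => jointDensity d N V β Y σ) X = 0 := by
  simp only [pDiv, pLap, pDeriv_jointDensity d N V hV, mul_assoc _ (grad d V _ _) _,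
    pDeriv_const_mul]
  rw [Finset.mul_sum, ← Finset.sum_add_distrib]
  exact Finset.sum_eq_zero fun i _ => by ring

/-- For fixed `X`, the joint density is proportional to the conditional permutation weights. -/
theorem exists_jointDensity_eq_mul_condWeight (d N : ℕ) [NeZero N] (V : (Fin d → ℝ) → ℝ)
    (β : Fin N → ℝ) (hβ : β 0 ≠ 0) (X : Fin N → Fin d → ℝ) :
    ∃ c : ℝ, ∀ σ, jointDensity d N V β X σ = c * condWeight d N V β σ X := by
  have hS : (∑ σ' : Equiv.Perm (Fin N),
      Real.exp (-(β 0) * permPotential d N V β X σ')) ≠ 0 :=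
    (Finset.sum_pos (fun _ _ => Real.exp_pos _) Finset.univ_nonempty).ne'
  refine ⟨((N.factorial : ℝ))⁻¹ * (∏ i, partZ d N V β i)⁻¹ *
    ∑ σ' : Equiv.Perm (Fin N), Real.exp (-(β 0) * permPotential d N V β X σ'), fun σ => ?_⟩
  rw [jointDensity_eq_exp, condWeight, mul_assoc _ (Finset.sum _ _) _, mul_div_cancel₀ _ hS,
    permPotential, neg_mul, mul_inv_cancel_left₀ hβ]

/-- for every swap frequency `ν > 0`, the joint density `ϱ(X,σ)` satisfies
the stationary forward Kolmogorov (Fokker–Planck) equation of the parallel-tempering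
stochastic switching process, pointwise in `(X,σ)`. -/
theorem jointDensity_stationary
    (d N : ℕ) (hd : 1 ≤ d) [NeZero N]
    (V : (Fin d → ℝ) → ℝ) (hV : ContDiff ℝ 2 V)
    (β : Fin N → ℝ) (hβ : ∀ i, 0 < β i)
    (hZint : ∀ i, Integrable (fun x : Fin d → ℝ => Real.exp (-(β i) * V x)))
    (hZpos : ∀ i, 0 < partZ d N V β i)
    (h : Equiv.Perm (Fin N) → Equiv.Perm (Fin N) → (Fin N → Fin d → ℝ) → ℝ)
    (h_nonneg : ∀ σ σ' X, 0 ≤ h σ σ' X)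
    (h_db : ∀ σ σ' X, condWeight d N V β σ X * h σ σ' X
        = condWeight d N V β σ' X * h σ' σ X)
    (ν : ℝ) (hν : 0 < ν) :
    ∀ (X : Fin N → Fin d → ℝ) (σ : Equiv.Perm (Fin N)),
      (∑ k : Fin N,
        (pDiv d N k
            (fun Y i => (β 0)⁻¹ * β (σ k) * grad d V (Y k) i * jointDensity d N V β Y σ) X
          + (β 0)⁻¹ * pLap d N k (fun Y => jointDensity d N V β Y σ) X))
      - ν * ∑ σ' ∈ Finset.univ.erase σ, h σ σ' X * jointDensity d N V β X σ
      + ν * ∑ σ' ∈ Finset.univ.erase σ, h σ' σ X * jointDensity d N V β X σ' = 0 := by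
  intro X σ
  have hjump (σ' : Equiv.Perm (Fin N)) :
      h σ' σ X * jointDensity d N V β X σ' = h σ σ' X * jointDensity d N V β X σ := by
    obtain ⟨c, hc⟩ := exists_jointDensity_eq_mul_condWeight d N V β (hβ 0).ne' X
    rw [hc, hc]
    linear_combination -c * h_db σ σ' X
  simp only [pDiv_add_pLap_jointDensity d N V (hV.differentiable two_ne_zero), hjump,
    Finset.sum_const_zero]
  ring
end

section
/- For each k ∈ {1,…,N}, the second moment of the parallel-tempering estimator is bounded by the second moment of the observable at temperature β_k: ∫_{(ℝ^d)^N} ( Σ_{j=1}^N A(x_j) η_{j,k}(X) )² ϱ(X) dX ≤ ∫_{ℝ^d} |A(x)|² ρ_{β_k}(x) dx. -/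
open Real Equiv Finset MeasureTheory

/-- The occupation probabilities `η_{j,k}(X) = ∑_σ 1_{σ(j)=k} ϱ(σ∣X)`. -/
noncomputable def occProb (d N : ℕ) [NeZero N] (V : (Fin d → ℝ) → ℝ) (β : Fin N → ℝ)
    (j k : Fin N) (X : Fin N → Fin d → ℝ) : ℝ :=
  ∑ σ : Equiv.Perm (Fin N), (if σ j = k then (1:ℝ) else 0) * condWeight d N V β σ X

/-- The marginal density `ϱ(X) = ∑_σ ϱ(X,σ)`. -/
noncomputable def margDensity (d N : ℕ) (V : (Fin d → ℝ) → ℝ) (β : Fin N → ℝ)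
    (X : Fin N → Fin d → ℝ) : ℝ :=
  ∑ σ : Equiv.Perm (Fin N), jointDensity d N V β X σ

/-- The partition functions factor out of the joint density. -/
lemma jointDensity_eq (d N : ℕ) [NeZero N] (V : (Fin d → ℝ) → ℝ) (β : Fin N → ℝ) (h0 : β 0 ≠ 0)
    (X : Fin N → Fin d → ℝ) (σ : Equiv.Perm (Fin N)) :
    jointDensity d N V β X σ = ((N.factorial : ℝ)⁻¹ * ∏ i, (partZ d N V β i)⁻¹) *
      Real.exp (-(β 0) * permPotential d N V β X σ) := by
  have hexp : -(β 0) * permPotential d N V β X σ = ∑ i, -(β (σ i)) * V (X i) := by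
    rw [permPotential, neg_mul, mul_inv_cancel_left₀ h0, ← Finset.sum_neg_distrib]
    simp only [neg_mul]
  rw [hexp, Real.exp_sum, ← Equiv.prod_comp σ fun i => (partZ d N V β i)⁻¹, mul_assoc,
    ← Finset.prod_mul_distrib]
  rfl

lemma condWeight_nonneg (d N : ℕ) [NeZero N] (V : (Fin d → ℝ) → ℝ) (β : Fin N → ℝ)
    (σ : Equiv.Perm (Fin N)) (X : Fin N → Fin d → ℝ) : 0 ≤ condWeight d N V β σ X := by
  unfold condWeight
  positivity

lemma sum_exp_permPotential_pos (d N : ℕ) [NeZero N] (V : (Fin d → ℝ) → ℝ) (β : Fin N → ℝ)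
    (X : Fin N → Fin d → ℝ) :
    0 < ∑ σ : Equiv.Perm (Fin N), Real.exp (-(β 0) * permPotential d N V β X σ) :=
  Finset.sum_pos (fun _ _ => Real.exp_pos _) Finset.univ_nonempty

lemma sum_condWeight (d N : ℕ) [NeZero N] (V : (Fin d → ℝ) → ℝ) (β : Fin N → ℝ)
    (X : Fin N → Fin d → ℝ) : ∑ σ, condWeight d N V β σ X = 1 := by
  simp only [condWeight]
  have hpos := (sum_exp_permPotential_pos d N V β X).ne'
  rw [← Finset.sum_div, div_self hpos]

/-- The conditional weight is the joint density divided by the marginal density. -/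
lemma condWeight_mul_margDensity (d N : ℕ) [NeZero N] (V : (Fin d → ℝ) → ℝ) (β : Fin N → ℝ)
    (h0 : β 0 ≠ 0) (X : Fin N → Fin d → ℝ) (σ : Equiv.Perm (Fin N)) :
    condWeight d N V β σ X * margDensity d N V β X = jointDensity d N V β X σ := by
  have hpos := (sum_exp_permPotential_pos d N V β X).ne'
  simp only [margDensity, jointDensity_eq d N V β h0, ← Finset.mul_sum, condWeight]
  field_simp

/-- The estimator averages the observable at the replica occupying temperature `k`. -/
lemma sum_mul_occProb (d N : ℕ) [NeZero N] (V : (Fin d → ℝ) → ℝ) (β : Fin N → ℝ)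
    (A : (Fin d → ℝ) → ℝ) (k : Fin N) (X : Fin N → Fin d → ℝ) :
    ∑ j, A (X j) * occProb d N V β j k X =
      ∑ σ : Equiv.Perm (Fin N), condWeight d N V β σ X * A (X (σ.symm k)) := by
  simp only [occProb, Finset.mul_sum]
  rw [Finset.sum_comm]
  refine Finset.sum_congr rfl fun σ _ => ?_
  rw [Finset.sum_eq_single (σ.symm k)]
  · simp [mul_comm]
  · intro j _ hj
    rw [if_neg fun h => hj (by rw [← h, Equiv.symm_apply_apply])]
    ring
  · simp

lemma boltz_nonneg (d N : ℕ) (V : (Fin d → ℝ) → ℝ) (β : Fin N → ℝ) (i : Fin N) (x : Fin d → ℝ) :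
    0 ≤ boltz d N V β i x :=
  mul_nonneg (inv_nonneg.2 (integral_nonneg fun _ => (Real.exp_pos _).le)) (Real.exp_pos _).le

lemma margDensity_nonneg (d N : ℕ) (V : (Fin d → ℝ) → ℝ) (β : Fin N → ℝ)
    (X : Fin N → Fin d → ℝ) : 0 ≤ margDensity d N V β X :=
  Finset.sum_nonneg fun _ _ => mul_nonneg (by positivity)
    (Finset.prod_nonneg fun _ _ => boltz_nonneg ..)

/-- Jensen's inequality for the conditional average over permutations. -/
lemma sq_estimator_mul_margDensity_le (d N : ℕ) [NeZero N] (V : (Fin d → ℝ) → ℝ)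
    (β : Fin N → ℝ) (h0 : β 0 ≠ 0) (A : (Fin d → ℝ) → ℝ) (k : Fin N) (X : Fin N → Fin d → ℝ) :
    (∑ j, A (X j) * occProb d N V β j k X) ^ 2 * margDensity d N V β X ≤
      ∑ σ : Equiv.Perm (Fin N), |A (X (σ.symm k))| ^ 2 * jointDensity d N V β X σ := by
  have jensen := Real.pow_arith_mean_le_arith_mean_pow_of_even Finset.univ
    (fun σ => condWeight d N V β σ X) (fun σ => A (X (σ.symm k)))
    (fun σ _ => condWeight_nonneg d N V β σ X) (sum_condWeight d N V β X) even_two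
  rw [sum_mul_occProb]
  refine (mul_le_mul_of_nonneg_right jensen (margDensity_nonneg d N V β X)).trans_eq ?_
  rw [Finset.sum_mul]
  refine Finset.sum_congr rfl fun σ _ => ?_
  rw [← condWeight_mul_margDensity d N V β h0, sq_abs]
  ring

/-- Weighting one coordinate of a product density gives a product of functions of the
coordinates. -/
lemma sq_mul_jointDensity_eq (d N : ℕ) (V : (Fin d → ℝ) → ℝ) (β : Fin N → ℝ)
    (A : (Fin d → ℝ) → ℝ) (k : Fin N) (X : Fin N → Fin d → ℝ) (σ : Equiv.Perm (Fin N)) :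
    |A (X (σ.symm k))| ^ 2 * jointDensity d N V β X σ = (N.factorial : ℝ)⁻¹ *
      ∏ i, (if σ i = k then |A (X i)| ^ 2 else 1) * boltz d N V β (σ i) (X i) := by
  have hprod : ∏ i, (if σ i = k then |A (X i)| ^ 2 else 1) = |A (X (σ.symm k))| ^ 2 := by
    simp only [← Equiv.eq_symm_apply, Finset.prod_ite_eq', Finset.mem_univ, if_true]
  rw [Finset.prod_mul_distrib, hprod, jointDensity]
  ring

/-- the second moment of the parallel-tempering estimator is bounded by
the second moment of the observable at temperature `β_k`. -/
theorem estimator_variance_bound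
    (d N : ℕ) (hd : 1 ≤ d) [NeZero N]
    (V : (Fin d → ℝ) → ℝ) (hV : Measurable V)
    (β : Fin N → ℝ) (hβ : ∀ i, 0 < β i)
    (hZint : ∀ i, Integrable (fun x : Fin d → ℝ => Real.exp (-(β i) * V x)))
    (hZpos : ∀ i, 0 < partZ d N V β i)
    (A : (Fin d → ℝ) → ℝ) (hA : Measurable A)
    (hA2 : ∀ i, Integrable (fun x : Fin d → ℝ => |A x| ^ 2 * Real.exp (-(β i) * V x))) :
    ∀ k : Fin N,
      (∫ X : Fin N → Fin d → ℝ,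
          (∑ j : Fin N, A (X j) * occProb d N V β j k X) ^ 2 * margDensity d N V β X)
        ≤ ∫ x : Fin d → ℝ, |A x| ^ 2 * boltz d N V β k x := by
  intro k
  have h0 := (hβ 0).ne'
  have hint (σ : Equiv.Perm (Fin N)) (i : Fin N) : Integrable fun x : Fin d → ℝ =>
      (if σ i = k then |A x| ^ 2 else 1) * boltz d N V β (σ i) x := by
    by_cases h : σ i = k
    · simpa only [h, if_true, boltz, mul_left_comm] using (hA2 k).const_mul (partZ d N V β k)⁻¹
    · simpa only [h, if_false, one_mul, boltz] using (hZint (σ i)).const_mul _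
  have hone (i : Fin N) : ∫ x, boltz d N V β i x = 1 := by
    simp only [boltz, integral_const_mul]
    exact inv_mul_cancel₀ (hZpos i).ne'
  have hterm (σ : Equiv.Perm (Fin N)) :
      Integrable fun X : Fin N → Fin d → ℝ =>
        |A (X (σ.symm k))| ^ 2 * jointDensity d N V β X σ := by
    simp only [sq_mul_jointDensity_eq]
    exact (Integrable.fintype_prod (hint σ)).const_mul _
  have hval (σ : Equiv.Perm (Fin N)) :
      ∫ X : Fin N → Fin d → ℝ, |A (X (σ.symm k))| ^ 2 * jointDensity d N V β X σ =
        (N.factorial : ℝ)⁻¹ * ∫ x, |A x| ^ 2 * boltz d N V β k x := by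
    simp only [sq_mul_jointDensity_eq]
    rw [integral_const_mul, integral_fintype_prod_volume_eq_prod (fun i x =>
      (if σ i = k then |A x| ^ 2 else 1) * boltz d N V β (σ i) x),
      Finset.prod_eq_single (σ.symm k)]
    · simp
    · intro i _ hi
      have h : σ i ≠ k := fun h => hi (by rw [← h, Equiv.symm_apply_apply])
      simp only [h, if_false, one_mul, hone]
    · simp
  calc _ ≤ ∫ X : Fin N → Fin d → ℝ, ∑ σ : Equiv.Perm (Fin N),
        |A (X (σ.symm k))| ^ 2 * jointDensity d N V β X σ :=
        integral_mono_of_nonneg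
          (.of_forall fun X => mul_nonneg (sq_nonneg _) (margDensity_nonneg d N V β X))
          (integrable_finsetSum _ fun σ _ => hterm σ)
          (.of_forall (sq_estimator_mul_margDensity_le d N V β h0 A k))
    _ = ∫ x, |A x| ^ 2 * boltz d N V β k x := by
        rw [integral_finsetSum _ fun σ _ => hterm σ]
        simp only [hval, Finset.sum_const, Finset.card_univ, Fintype.card_perm, Fintype.card_fin,
          nsmul_eq_mul]
        exact mul_inv_cancel_left₀ (by positivity) _
end

section
/- Assume V is continuously differentiable. Then the gradient of the mixture potential 𝒱(X) = −β⁻¹ log Σ_{σ∈S_N} e^{−β𝒱(X,σ)} satisfies, for every X ∈ (ℝ^d)^N and every j ∈ {1,…,N}: ∇_{x_j} 𝒱(X) = Σ_{σ∈S_N} ϱ(σ∣X) ∇_{x_j} 𝒱(X,σ) = R_j(X) ∇V(x_j). Hence the infinite-swapping dynamics dx_j = −R_j(X)∇V(x_j) dt + √(2β⁻¹) dW_j is a gradient diffusion on the mixture potential 𝒱(X). -/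
open Real Equiv Finset

/-- The drift-scaling factors `R_j(X) = β⁻¹ ∑_σ β_{σ(j)} ϱ(σ∣X)`. -/
noncomputable def driftFactor (d N : ℕ) [NeZero N] (V : (Fin d → ℝ) → ℝ) (β : Fin N → ℝ)
    (j : Fin N) (X : Fin N → Fin d → ℝ) : ℝ :=
  (β 0)⁻¹ * ∑ σ : Equiv.Perm (Fin N), β (σ j) * condWeight d N V β σ X

/-- The mixture potential `𝒱(X) = −β⁻¹ log ∑_σ e^{−β 𝒱(X,σ)}`. -/
noncomputable def mixturePotential (d N : ℕ) [NeZero N] (V : (Fin d → ℝ) → ℝ)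
    (β : Fin N → ℝ) (X : Fin N → Fin d → ℝ) : ℝ :=
  -(β 0)⁻¹ * Real.log (∑ σ : Equiv.Perm (Fin N),
      Real.exp (-(β 0) * permPotential d N V β X σ))

/-- Derivative of the free energy `-b⁻¹ log ∑ₛ exp (-b fₛ)`: the Gibbs average of the
derivatives of the `fₛ`. -/
theorem hasFDerivAt_neg_inv_mul_log_sum_exp {E ι : Type*} [NormedAddCommGroup E]
    [NormedSpace ℝ E] [Fintype ι] [Nonempty ι] {b : ℝ} (hb : b ≠ 0) {f : ι → E → ℝ}
    {f' : ι → E →L[ℝ] ℝ} {x : E} (hf : ∀ s, HasFDerivAt (f s) (f' s) x) :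
    HasFDerivAt (fun y => -b⁻¹ * Real.log (∑ s, Real.exp (-b * f s y)))
      (∑ s, (Real.exp (-b * f s x) / ∑ t, Real.exp (-b * f t x)) • f' s) x := by
  have hpos : 0 < ∑ s, Real.exp (-b * f s x) :=
    Finset.sum_pos (fun s _ => Real.exp_pos _) Finset.univ_nonempty
  have h := ((HasFDerivAt.fun_sum (u := Finset.univ)
    fun s _ => ((hf s).const_mul (-b)).exp).log hpos.ne').const_mul (-b⁻¹)
  refine h.congr_fderiv ?_
  simp only [Finset.smul_sum, smul_smul]
  refine Finset.sum_congr rfl fun s _ => ?_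
  congr 1
  field_simp

theorem hasFDerivAt_permPotential {d N : ℕ} [NeZero N] {V : (Fin d → ℝ) → ℝ}
    (hV : Differentiable ℝ V) (β : Fin N → ℝ) (σ : Equiv.Perm (Fin N))
    (X : Fin N → Fin d → ℝ) :
    HasFDerivAt (fun Y => permPotential d N V β Y σ)
      ((β 0)⁻¹ • ∑ k : Fin N, β (σ k) •
        (fderiv ℝ V (X k)).comp (ContinuousLinearMap.proj (R := ℝ) k)) X := by
  unfold permPotential
  refine (HasFDerivAt.fun_sum fun k _ => ?_).const_mul _
  exact ((hV (X k)).hasFDerivAt.comp X (hasFDerivAt_apply k X)).const_mul _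

theorem pDeriv_permPotential {d N : ℕ} [NeZero N] {V : (Fin d → ℝ) → ℝ}
    (hV : Differentiable ℝ V) (β : Fin N → ℝ) (σ : Equiv.Perm (Fin N))
    (X : Fin N → Fin d → ℝ) (j : Fin N) (i : Fin d) :
    pDeriv d N j i (fun Y => permPotential d N V β Y σ) X
      = (β 0)⁻¹ * (β (σ j) * grad d V (X j) i) := by
  rw [pDeriv, (hasFDerivAt_permPotential hV β σ X).fderiv]
  simp only [smul_apply, _root_.sum_apply,
    ContinuousLinearMap.comp_apply, ContinuousLinearMap.proj_apply, smul_eq_mul, grad]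
  rw [Finset.sum_eq_single_of_mem j (Finset.mem_univ j), Pi.single_eq_same]
  intro k _ hk
  rw [Pi.single_eq_of_ne hk, map_zero, mul_zero]

theorem pDeriv_mixturePotential {d N : ℕ} [NeZero N] {V : (Fin d → ℝ) → ℝ}
    (hV : Differentiable ℝ V) {β : Fin N → ℝ} (hβ : β 0 ≠ 0)
    (X : Fin N → Fin d → ℝ) (j : Fin N) (i : Fin d) :
    pDeriv d N j i (mixturePotential d N V β) X
      = ∑ σ : Equiv.Perm (Fin N),
          condWeight d N V β σ X * pDeriv d N j i (fun Y => permPotential d N V β Y σ) X := by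
  have hperm : ∀ σ : Equiv.Perm (Fin N), HasFDerivAt (fun Y => permPotential d N V β Y σ)
      (fderiv ℝ (fun Y => permPotential d N V β Y σ) X) X := fun σ =>
    (hasFDerivAt_permPotential hV β σ X).differentiableAt.hasFDerivAt
  have hmix : HasFDerivAt (mixturePotential d N V β) _ X :=
    hasFDerivAt_neg_inv_mul_log_sum_exp hβ hperm
  rw [pDeriv, hmix.fderiv, _root_.sum_apply]
  rfl

/-- for `V` continuously differentiable, the gradient of the mixture
potential satisfies `∇_{x_j} 𝒱(X) = ∑_σ ϱ(σ∣X) ∇_{x_j} 𝒱(X,σ) = R_j(X) ∇V(x_j)`;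
hence the infinite-swapping dynamics is a gradient diffusion on the mixture potential. -/
theorem grad_mixturePotential
    (d N : ℕ) (hd : 1 ≤ d) [NeZero N]
    (V : (Fin d → ℝ) → ℝ) (hV : ContDiff ℝ 1 V)
    (β : Fin N → ℝ) (hβ : ∀ i, 0 < β i) :
    ∀ (X : Fin N → Fin d → ℝ) (j : Fin N) (i : Fin d),
      pDeriv d N j i (mixturePotential d N V β) X
          = ∑ σ : Equiv.Perm (Fin N),
              condWeight d N V β σ X * pDeriv d N j i (fun Y => permPotential d N V β Y σ) X
      ∧ pDeriv d N j i (mixturePotential d N V β) X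
          = driftFactor d N V β j X * grad d V (X j) i := by
  intro X j i
  have hV' : Differentiable ℝ V := hV.differentiable one_ne_zero
  have h := pDeriv_mixturePotential hV' (hβ 0).ne' X j i
  refine ⟨h, h.trans ?_⟩
  simp only [pDeriv_permPotential hV', driftFactor, Finset.mul_sum, Finset.sum_mul]
  exact Finset.sum_congr rfl fun σ _ => by ring
end

section
/- Assume V is twice continuously differentiable. Set ρ(x) = Σ_{i=1}^N n_i e^{−β_i V(x)} and β̄(x) = ( Σ_{i=1}^N β_i n_i e^{−β_i V(x)} ) / ( Σ_{i=1}^N n_i e^{−β_i V(x)} ). Then the probability flux vanishes identically: β⁻¹ β̄(x) ∇V(x) ρ(x) + β⁻¹ ∇ρ(x) = 0 for every x ∈ ℝ^d; consequently div( β⁻¹ β̄(x) ∇V(x) ρ(x) + β⁻¹ ∇ρ(x) ) = 0, i.e. ρ is a stationary density of the effective dynamics dx = −β⁻¹ β̄(x) ∇V(x) dt + √(2β⁻¹) dW obtained in the infinite-switch limit of simulated tempering. -/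
open Real Finset

/-- Divergence of a vector field on `ℝ^d`. -/
noncomputable def div' (d : ℕ) (F : (Fin d → ℝ) → Fin d → ℝ) (x : Fin d → ℝ) : ℝ :=
  ∑ i : Fin d, fderiv ℝ (fun y => F y i) x (Pi.single i 1)

/-- The mixture marginal density `ρ(x) = ∑ᵢ nᵢ e^{−βᵢ V(x)}`. -/
noncomputable def stMarg (d N : ℕ) (V : (Fin d → ℝ) → ℝ) (βs : Fin N → ℝ)
    (n : Fin N → ℝ) (x : Fin d → ℝ) : ℝ :=
  ∑ i : Fin N, n i * Real.exp (-(βs i) * V x)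

/-- The averaged inverse temperature
`β̄(x) = (∑ᵢ βᵢ nᵢ e^{−βᵢ V(x)}) / (∑ᵢ nᵢ e^{−βᵢ V(x)})`. -/
noncomputable def avgBeta (d N : ℕ) (V : (Fin d → ℝ) → ℝ) (βs : Fin N → ℝ)
    (n : Fin N → ℝ) (x : Fin d → ℝ) : ℝ :=
  (∑ i : Fin N, βs i * (n i * Real.exp (-(βs i) * V x))) /
    ∑ i : Fin N, n i * Real.exp (-(βs i) * V x)

/-- The gradient of the mixture marginal is `-(∑ᵢ βᵢ nᵢ e^{−βᵢ V}) ∇V`. -/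
theorem grad_stMarg {d N : ℕ} {V : (Fin d → ℝ) → ℝ} (βs n : Fin N → ℝ) {x : Fin d → ℝ}
    (hV : DifferentiableAt ℝ V x) (l : Fin d) :
    grad d (stMarg d N V βs n) x l =
      -((∑ i : Fin N, βs i * (n i * Real.exp (-(βs i) * V x))) * grad d V x l) := by
  have h : HasFDerivAt (stMarg d N V βs n)
      (∑ i : Fin N, n i • (Real.exp (-(βs i) * V x) • (-(βs i) • fderiv ℝ V x))) x :=
    HasFDerivAt.fun_sum fun i _ =>
      ((hV.hasFDerivAt.const_mul (-(βs i))).exp).const_mul (n i)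
  simp only [grad, h.fderiv, _root_.sum_apply, _root_.smul_apply,
    smul_eq_mul, Finset.sum_mul, ← Finset.sum_neg_distrib]
  exact Finset.sum_congr rfl fun i _ => by ring

/-- The mixture marginal is positive when there is at least one positive weight. -/
theorem stMarg_pos {d N : ℕ} (hN : 1 ≤ N) (V : (Fin d → ℝ) → ℝ) (βs : Fin N → ℝ)
    {n : Fin N → ℝ} (hn : ∀ i, 0 < n i) (x : Fin d → ℝ) : 0 < stMarg d N V βs n x :=
  Finset.sum_pos (fun i _ => mul_pos (hn i) (Real.exp_pos _)) ⟨⟨0, hN⟩, Finset.mem_univ _⟩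

/-- the mixture marginal `ρ(x) = ∑ᵢ nᵢ e^{−βᵢV(x)}` has identically
vanishing probability flux for the infinite-switch simulated-tempering dynamics:
`β⁻¹ β̄(x) ∇V(x) ρ(x) + β⁻¹ ∇ρ(x) = 0`, and consequently the divergence of the flux
vanishes, i.e. `ρ` is a stationary density of the effective dynamics
`dx = −β⁻¹β̄(x)∇V(x)dt + √(2β⁻¹)dW`. -/
theorem infinite_switch_marginal_zero_flux
    (d N : ℕ) (hd : 1 ≤ d) (hN : 1 ≤ N)
    (β : ℝ) (hβ : 0 < β)
    (βs : Fin N → ℝ) (hβs : ∀ i, 0 < βs i)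
    (n : Fin N → ℝ) (hn : ∀ i, 0 < n i)
    (V : (Fin d → ℝ) → ℝ) (hV : ContDiff ℝ 2 V) :
    (∀ (x : Fin d → ℝ) (l : Fin d),
      β⁻¹ * avgBeta d N V βs n x * grad d V x l * stMarg d N V βs n x
        + β⁻¹ * grad d (stMarg d N V βs n) x l = 0)
    ∧ (∀ x : Fin d → ℝ,
        div' d (fun y l => β⁻¹ * avgBeta d N V βs n y * grad d V y l * stMarg d N V βs n y
          + β⁻¹ * grad d (stMarg d N V βs n) y l) x = 0) := by
  have flux : ∀ (x : Fin d → ℝ) (l : Fin d),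
      β⁻¹ * avgBeta d N V βs n x * grad d V x l * stMarg d N V βs n x
        + β⁻¹ * grad d (stMarg d N V βs n) x l = 0 := by
    intro x l
    have havg : avgBeta d N V βs n x * stMarg d N V βs n x =
        ∑ i : Fin N, βs i * (n i * Real.exp (-(βs i) * V x)) :=
      div_mul_cancel₀ _ (stMarg_pos hN V βs hn x).ne'
    rw [grad_stMarg βs n (hV.differentiable (by norm_num) x) l, ← havg]
    ring
  exact ⟨flux, fun x => by simp [div', flux]⟩
end
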